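/- Let X be a connected uniformly locally finite graph and T ≤ X any leafless end-respecting subtree (no separator assumption). Then Z^suf_1(T,ℤ) ∩ 𝒞(X,ℤ) = 0, and consequently the inclusion induces an injection Z^suf_1(T,ℤ) ↪ Z^suf_1(X,ℤ)/𝒞_∞(X,ℤ), i.e., H^uf_1(T,ℤ) embeds into H^uf_1(X,ℤ). The same holds with ℤ₂ coefficients: Z^suf_1(T,ℤ₂) ∩ 𝒞(X,ℤ₂) = 0. -/

import Mathlib

open scoped Classical

namespace UFH

variable {V : Type}

/-- Uniform local finiteness: a uniform bound on vertex degrees. -/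
def ULF (G : SimpleGraph V) : Prop :=
  ∃ D : ℕ, ∀ v : V, (G.neighborSet v).Finite ∧ (G.neighborSet v).ncard ≤ D

/-- An integer 1-chain: antisymmetric and supported on adjacent pairs. -/
def IsChain1 (G : SimpleGraph V) (f : V → V → ℤ) : Prop :=
  (∀ u v, f u v = - f v u) ∧ ∀ u v, f u v ≠ 0 → G.Adj u v

/-- A mod-2 1-chain: symmetric and supported on adjacent pairs. -/
def IsChain1Z2 (G : SimpleGraph V) (f : V → V → ZMod 2) : Prop :=
  (∀ u v, f u v = f v u) ∧ ∀ u v, f u v ≠ 0 → G.Adj u v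

/-- Divergence of an integer 1-chain at a vertex. -/
noncomputable def chainDiv (f : V → V → ℤ) (v : V) : ℤ := ∑ᶠ u, f u v

/-- Divergence of a mod-2 1-chain at a vertex. -/
noncomputable def chainDivZ2 (f : V → V → ZMod 2) (v : V) : ZMod 2 := ∑ᶠ u, f u v

def Bdd (f : V → V → ℤ) (C : ℕ) : Prop := ∀ u v, |f u v| ≤ (C : ℤ)

/-- The sup-norm of a bounded integer 1-chain (least uniform bound). -/
noncomputable def chainNorm (f : V → V → ℤ) : ℕ := sInf {C : ℕ | Bdd f C}

/-- Bounded integer flows: bounded 1-chains with vanishing divergence everywhere. -/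
def Zsuf1 (G : SimpleGraph V) : Set (V → V → ℤ) :=
  {f | IsChain1 G f ∧ (∃ C, Bdd f C) ∧ ∀ v, chainDiv f v = 0}

/-- Mod-2 cycles: mod-2 1-chains whose support meets every vertex evenly. -/
def Zsuf1Z2 (G : SimpleGraph V) : Set (V → V → ZMod 2) :=
  {f | IsChain1Z2 G f ∧ ∀ v, chainDivZ2 f v = 0}

/-- A circuit: a closed walk (based at some vertex). -/
abbrev Circuit (G : SimpleGraph V) := Σ v : V, G.Walk v v

/-- Number of traversals of the oriented edge `(a, b)` by the walk `p`. -/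
noncomputable def traversals {G : SimpleGraph V} {u v : V} (p : G.Walk u v) (a b : V) : ℕ :=
  ((Finset.range p.length).filter fun i => p.getVert i = a ∧ p.getVert (i + 1) = b).card

/-- The integer 1-chain of signed traversals of a walk. -/
noncomputable def walkChain {G : SimpleGraph V} {u v : V} (p : G.Walk u v) (a b : V) : ℤ :=
  (traversals p a b : ℤ) - (traversals p b a : ℤ)

/-- The mod-2 1-chain of traversals of a walk. -/
noncomputable def walkChainZ2 {G : SimpleGraph V} {u v : V} (p : G.Walk u v) (a b : V) : ZMod 2 :=
  (traversals p a b : ZMod 2) + (traversals p b a : ZMod 2)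

/-- The walk `p` passes through the edge `{a, b}`. -/
def OnWalk {G : SimpleGraph V} {u v : V} (p : G.Walk u v) (a b : V) : Prop :=
  ∃ i < p.length, (p.getVert i = a ∧ p.getVert (i + 1) = b) ∨
    (p.getVert i = b ∧ p.getVert (i + 1) = a)

/-- A coefficient family on circuits is thin (locally finite). -/
def ThinCoef (G : SimpleGraph V) (g : Circuit G → ℤ) : Prop :=
  ∀ a b : V, {c : Circuit G | g c ≠ 0 ∧ OnWalk c.2 a b}.Finite

def ThinCoefZ2 (G : SimpleGraph V) (g : Circuit G → ZMod 2) : Prop :=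
  ∀ a b : V, {c : Circuit G | g c ≠ 0 ∧ OnWalk c.2 a b}.Finite

/-- The 1-chain obtained as the (pointwise) sum of a family of circuits with coefficients. -/
noncomputable def circSum (G : SimpleGraph V) (g : Circuit G → ℤ) : V → V → ℤ :=
  fun a b => ∑ᶠ c : Circuit G, g c * walkChain c.2 a b

noncomputable def circSumZ2 (G : SimpleGraph V) (g : Circuit G → ZMod 2) : V → V → ZMod 2 :=
  fun a b => ∑ᶠ c : Circuit G, g c * walkChainZ2 c.2 a b

/-- 𝒞_r(X, ℤ): sums of circuits of length ≤ r with uniformly bounded integer coefficients. -/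
def Cr (G : SimpleGraph V) (r : ℕ) : Set (V → V → ℤ) :=
  {f | ∃ g : Circuit G → ℤ, (∃ C : ℕ, ∀ c, |g c| ≤ (C : ℤ)) ∧
    (∀ c, g c ≠ 0 → c.2.length ≤ r) ∧ ThinCoef G g ∧ f = circSum G g}

/-- 𝒞_∞(X, ℤ). -/
def Cinf (G : SimpleGraph V) : Set (V → V → ℤ) := ⋃ r : ℕ, Cr G r

/-- 𝒞(X, ℤ): thin sums of circuits with integer coefficients whose result is bounded. -/
def Cthin (G : SimpleGraph V) : Set (V → V → ℤ) :=
  {f | ∃ g : Circuit G → ℤ, ThinCoef G g ∧ (∃ C, Bdd f C) ∧ f = circSum G g}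

/-- 𝒞_r(X, ℤ₂). -/
def CrZ2 (G : SimpleGraph V) (r : ℕ) : Set (V → V → ZMod 2) :=
  {f | ∃ g : Circuit G → ZMod 2, (∀ c, g c ≠ 0 → c.2.length ≤ r) ∧
    ThinCoefZ2 G g ∧ f = circSumZ2 G g}

/-- 𝒞_∞(X, ℤ₂). -/
def CinfZ2 (G : SimpleGraph V) : Set (V → V → ZMod 2) := ⋃ r : ℕ, CrZ2 G r

/-- 𝒞(X, ℤ₂): thin sums of circuits mod 2. -/
def CthinZ2 (G : SimpleGraph V) : Set (V → V → ZMod 2) :=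
  {f | ∃ g : Circuit G → ZMod 2, ThinCoefZ2 G g ∧ f = circSumZ2 G g}

/-- `a` and `b` are joined by a walk avoiding the set `K`. -/
def ConnAvoiding (G : SimpleGraph V) (K : Set V) (a b : V) : Prop :=
  ∃ p : G.Walk a b, ∀ v ∈ p.support, v ∉ K

/-- A (one-sided infinite) ray in `G`. -/
def IsRay (G : SimpleGraph V) (x : ℕ → V) : Prop :=
  Function.Injective x ∧ ∀ n, G.Adj (x n) (x (n + 1))

/-- Two rays determine the same end. -/
def RayEquiv (G : SimpleGraph V) (x y : ℕ → V) : Prop :=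
  ∀ K : Finset V, ∃ N, ∀ n, N ≤ n → ∀ m, N ≤ m → ConnAvoiding G (↑K) (x n) (y m)

/-- The connected component of `v` in `X − K`. -/
def Component (G : SimpleGraph V) (K : Set V) (v : V) : Set V :=
  {u | u ∉ K ∧ ConnAvoiding G K u v}

def MoreThanOneEnd (G : SimpleGraph V) : Prop :=
  ∃ K : Finset V, ∃ v w : V, v ∉ K ∧ w ∉ K ∧ (Component G (↑K) v).Infinite ∧
    (Component G (↑K) w).Infinite ∧ ¬ ConnAvoiding G (↑K) v w

def OneEnded (G : SimpleGraph V) : Prop :=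
  Infinite V ∧ ∀ K : Finset V, ∃ v, v ∉ K ∧ (Component G (↑K) v).Infinite ∧
    ∀ u, u ∉ K → (Component G (↑K) u).Infinite → ConnAvoiding G (↑K) u v

/-- A bip: a bi-infinite path, i.e. injective graph morphism ℤ → T. -/
def IsBip (T : SimpleGraph V) (b : ℤ → V) : Prop :=
  Function.Injective b ∧ ∀ n : ℤ, T.Adj (b n) (b (n + 1))

/-- The bip `b` lies over the edge `{u, v}`. -/
def LiesOver (b : ℤ → V) (u v : V) : Prop :=
  ∃ n : ℤ, (b n = u ∧ b (n + 1) = v) ∨ (b n = v ∧ b (n + 1) = u)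

/-- The signed traversal of the oriented edge `(u, v)` by the bip `b`. -/
noncomputable def bipSign (b : ℤ → V) (u v : V) : ℤ :=
  if ∃ n : ℤ, b n = u ∧ b (n + 1) = v then 1
  else if ∃ n : ℤ, b n = v ∧ b (n + 1) = u then -1 else 0

noncomputable def bipOverZ2 (b : ℤ → V) (u v : V) : ZMod 2 :=
  if LiesOver b u v then 1 else 0

/-- `p` is the last bip of `P` (w.r.t. the order `r`) lying over the edge `{u, v}`. -/
def IsLast (P : Set (ℤ → V)) (r : (ℤ → V) → (ℤ → V) → Prop) (p : ℤ → V) (u v : V) : Prop :=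
  LiesOver p u v ∧ ∀ q ∈ P, q ≠ p → LiesOver q u v → r q p

/-- The 1-chain associated to coefficients on a family of bips. -/
noncomputable def bipMap (P : Set (ℤ → V)) (f : ↥P → ℤ) : V → V → ℤ :=
  fun u v => ∑ᶠ p : ↥P, f p * bipSign p.1 u v

noncomputable def bipMapZ2 (P : Set (ℤ → V)) (f : ↥P → ZMod 2) : V → V → ZMod 2 :=
  fun u v => ∑ᶠ p : ↥P, f p * bipOverZ2 p.1 u v

/-- The set `S` is connected in the graph `H` (walks staying inside `S`). -/
def ConnectedIn (H : SimpleGraph V) (S : Set V) : Prop :=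
  ∀ a ∈ S, ∀ b ∈ S, ∃ p : H.Walk a b, ∀ v ∈ p.support, v ∈ S

/-- `T` is a subtree of `G`. -/
def IsSubtree (G T : SimpleGraph V) : Prop :=
  T ≤ G ∧ T.IsAcyclic ∧ T.support.Nonempty ∧ ConnectedIn T T.support

/-- Every vertex of `T` has degree ≥ 2 in `T`. -/
def Leafless (T : SimpleGraph V) : Prop :=
  ∀ v ∈ T.support, ∃ u w : V, u ≠ w ∧ T.Adj v u ∧ T.Adj v w

/-- Distinct ends of `T` determine distinct ends of `G`. -/
def EndRespecting (G T : SimpleGraph V) : Prop :=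
  ∀ x y : ℕ → V, IsRay T x → IsRay T y → RayEquiv G x y → RayEquiv T x y

/-- Every end of `G` is represented by a unique end of `T`. -/
def EndDefining (G T : SimpleGraph V) : Prop :=
  EndRespecting G T ∧ ∀ x : ℕ → V, IsRay G x → ∃ y : ℕ → V, IsRay T y ∧ RayEquiv G x y

/-- The subtree `T` of `G` has separators. -/
def HasSeparators (G T : SimpleGraph V) : Prop :=
  ∃ K : ℕ → Finset V,
    (∀ n, K n ⊆ K (n + 1)) ∧
    (∀ v : V, ∃ n, v ∈ K n) ∧
    (∀ n, ConnectedIn G (↑(K n))) ∧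
    (∀ n, ConnectedIn T (T.support ∩ ↑(K n))) ∧
    (∀ n, ∀ v : V, v ∉ K n → (Component G (↑(K n)) v).Infinite →
      ∃! e : V × V, T.Adj e.1 e.2 ∧ e.1 ∈ K n ∧ e.2 ∉ K n ∧
        e.2 ∈ Component G (↑(K n)) v) ∧
    (∀ n, ∀ a b : V, T.Adj a b → a ∈ K n → b ∉ K n → (Component G (↑(K n)) b).Infinite)

/-- An integer 2-chain: alternating, supported on triangles. -/
def IsChain2 (G : SimpleGraph V) (g : V → V → V → ℤ) : Prop :=
  (∀ u v w, g u v w = - g v u w) ∧ (∀ u v w, g u v w = - g u w v) ∧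
    ∀ u v w, g u v w ≠ 0 → G.Adj u v ∧ G.Adj v w ∧ G.Adj u w

def Bdd2 (g : V → V → V → ℤ) (C : ℕ) : Prop := ∀ u v w, |g u v w| ≤ (C : ℤ)

/-- The boundary of a 2-chain. -/
noncomputable def bd2 (g : V → V → V → ℤ) : V → V → ℤ := fun u v => ∑ᶠ w, g u v w

/-- `H^suf_1`-expansion. -/
def HsufExp1 (G : SimpleGraph V) : Prop :=
  ∃ K : ℕ → ℕ, ∀ U : Finset V, ∀ f : V → V → ℤ,
    IsChain1 G f →
    (∀ u v, f u v ≠ 0 → u ∈ U ∧ v ∈ U) →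
    (∀ v ∈ U, (∀ u, G.Adj u v → u ∈ U) → chainDiv f v = 0) →
    (∃ fh ∈ Zsuf1 G, (∀ u ∈ U, ∀ v ∈ U, fh u v = f u v) ∧ chainNorm fh = chainNorm f) →
    ∃ g : V → V → V → ℤ, IsChain2 G g ∧ Bdd2 g (K (chainNorm f)) ∧
      ∀ u ∈ U, ∀ v ∈ U, bd2 g u v = f u v

/-- Pure `H^suf_1`-expansion. -/
def PureHsufExp1 (G : SimpleGraph V) : Prop :=
  ∃ K : ℕ → ℕ, ∀ U : Finset V, ∀ f : V → V → ℤ,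
    IsChain1 G f →
    (∀ u v, f u v ≠ 0 → u ∈ U ∧ v ∈ U) →
    (∀ v ∈ U, (∀ u, G.Adj u v → u ∈ U) → chainDiv f v = 0) →
    (∃ fh : V → V → ℤ, IsChain1 G fh ∧
        (∃ g2 : V → V → V → ℤ, IsChain2 G g2 ∧ (∃ C, Bdd2 g2 C) ∧ bd2 g2 = fh) ∧
        (∀ u ∈ U, ∀ v ∈ U, fh u v = f u v) ∧ chainNorm fh = chainNorm f) →
    ∃ g : V → V → V → ℤ, IsChain2 G g ∧ Bdd2 g (K (chainNorm f)) ∧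
      ∀ u ∈ U, ∀ v ∈ U, bd2 g u v = f u v

/-- The Rips graph of radius `s`. -/
def rips (G : SimpleGraph V) (s : ℕ) : SimpleGraph V :=
  SimpleGraph.fromRel fun u v => G.dist u v ≤ s

/-- Pure `H^uf_1`-expansion: the Rips graphs eventually have pure `H^suf_1`-expansion. -/
def PureHufExp1 (G : SimpleGraph V) : Prop := ∃ s₀ : ℕ, ∀ s, s₀ ≤ s → PureHsufExp1 (rips G s)

def VertexTransitive (G : SimpleGraph V) : Prop := ∀ u v : V, ∃ φ : G ≃g G, φ u = v

/-- The edge boundary of a finite set of vertices. -/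
def edgeBoundary (G : SimpleGraph V) (U : Finset V) : Set (Sym2 V) :=
  {e | e ∈ G.edgeSet ∧ ∃ a b : V, e = s(a, b) ∧ a ∈ U ∧ b ∉ U}

/-- Mod-2 reduction of an integer 1-chain. -/
def mod2 (f : V → V → ℤ) : V → V → ZMod 2 := fun u v => ((f u v : ℤ) : ZMod 2)

/-- Pointwise domination of 1-chains: `r` flows in the same direction as `φ`, no stronger. -/
def chainLE (r φ : V → V → ℤ) : Prop :=
  ∀ u v, (0 ≤ φ u v → 0 ≤ r u v ∧ r u v ≤ φ u v) ∧ (φ u v ≤ 0 → φ u v ≤ r u v ∧ r u v ≤ 0)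

/-- A set of functions is locally finite (thin). -/
def ThinFamily {Y : Type} (F : Set (Y → ZMod 2)) : Prop := ∀ y : Y, {f ∈ F | f y ≠ 0}.Finite

/-- The pointwise sum of a (thin) set of functions. -/
noncomputable def thinSum {Y : Type} (F : Set (Y → ZMod 2)) : Y → ZMod 2 :=
  fun y => ∑ᶠ f : ↥F, f.1 y

/-- A thin-sum space: a subspace closed under thin sums. -/
def IsThinSumSpace {Y : Type} (W : Set (Y → ZMod 2)) : Prop :=
  0 ∈ W ∧ (∀ f ∈ W, ∀ g ∈ W, f + g ∈ W) ∧ ∀ F ⊆ W, ThinFamily F → thinSum F ∈ W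

/-- A thin-sum basis for a thin-sum space. -/
def IsThinSumBasis {Y : Type} (A W : Set (Y → ZMod 2)) : Prop :=
  A ⊆ W ∧ (∀ f ∈ W, ∃ F ⊆ A, ThinFamily F ∧ f = thinSum F) ∧
    ∀ F ⊆ A, ThinFamily F → F.Nonempty → thinSum F ≠ 0

/-- The vertices joined to `v` in `T` after deletion of the edge `{u, v}`. -/
def side (T : SimpleGraph V) (u v : V) : Set V :=
  {w | (T \ SimpleGraph.fromEdgeSet {s(u, v)}).Reachable v w}

lemma right_mem_side (T : SimpleGraph V) (u v : V) : v ∈ side T u v :=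
  SimpleGraph.Reachable.refl v

lemma left_notMem_side {T : SimpleGraph V} (hT : T.IsAcyclic) {u v : V} (h : T.Adj u v) :
    u ∉ side T u v := by
  intro hu
  have hb := SimpleGraph.isAcyclic_iff_forall_isBridge.1 hT (e := s(u, v)) h
  rw [SimpleGraph.isBridge_iff] at hb
  exact hb hu.symm

lemma eq_of_leaves_side {T : SimpleGraph V} (hT : T.IsAcyclic) {u v x y : V} (h : T.Adj u v)
    (hx : x ∈ side T u v) (hxy : T.Adj x y) (hy : y ∉ side T u v) : x = v ∧ y = u := by
  have hs : s(x, y) = s(u, v) := by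
    by_contra hne
    refine hy (SimpleGraph.Reachable.trans hx (SimpleGraph.Adj.reachable ?_))
    rw [SimpleGraph.sdiff_adj, SimpleGraph.fromEdgeSet_adj]
    exact ⟨hxy, fun hc => hne hc.1⟩
  rcases Sym2.eq_iff.1 hs with ⟨rfl, rfl⟩ | h'
  · exact absurd hx (left_notMem_side hT h)
  · exact h'

lemma side_induction {T : SimpleGraph V} {u v : V} {P : V → Prop} (h0 : P v)
    (hstep : ∀ x y, x ∈ side T u v → y ∈ side T u v → T.Adj x y → P x → P y) {w : V}
    (hw : w ∈ side T u v) : P w := by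
  have hw' := (SimpleGraph.reachable_iff_reflTransGen _ _).1 hw
  induction hw' with
  | refl => exact h0
  | @tail x y hx hxy ih =>
    have hxs : x ∈ side T u v := (SimpleGraph.reachable_iff_reflTransGen _ _).2 hx
    exact hstep x y hxs hw (SimpleGraph.sdiff_adj _ _ _ _ |>.1 hxy).1 (ih hxs)

lemma side_subset_side {T : SimpleGraph V} (hT : T.IsAcyclic) {u v w : V} (huv : T.Adj u v)
    (hvw : T.Adj v w) (hne : w ≠ u) : side T v w ⊆ side T u v := by
  intro x hx
  refine side_induction (P := fun x => x ∈ side T u v) ?_ ?_ hx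
  · by_contra hw
    exact hne (eq_of_leaves_side hT huv (right_mem_side T u v) hvw hw).2
  · intro x y hxs _ hxy hxu
    by_contra hy
    obtain ⟨rfl, -⟩ := eq_of_leaves_side hT huv hxu hxy hy
    exact left_notMem_side hT hvw hxs

lemma disjoint_side_swap {T : SimpleGraph V} (hT : T.IsAcyclic) {u v x : V} (h : T.Adj u v)
    (hx : x ∈ side T u v) : x ∉ side T v u := by
  intro hx'
  rw [side, Sym2.eq_swap] at hx'
  exact left_notMem_side hT h (SimpleGraph.Reachable.trans hx (SimpleGraph.Reachable.symm hx'))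

lemma mem_side_or_mem_side {T : SimpleGraph V} (hT : T.IsAcyclic) {u v x : V} (h : T.Adj u v)
    (hx : T.Reachable v x) : x ∈ side T u v ∨ x ∈ side T v u := by
  rw [SimpleGraph.reachable_iff_reflTransGen] at hx
  induction hx with
  | refl => exact Or.inl (right_mem_side T u v)
  | @tail x y _ hxy ih =>
    by_contra! hy
    rcases ih with ih | ih
    · obtain ⟨-, rfl⟩ := eq_of_leaves_side hT h ih hxy hy.1
      exact hy.2 (right_mem_side T _ _)
    · obtain ⟨-, rfl⟩ := eq_of_leaves_side hT h.symm ih hxy hy.2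
      exact hy.1 (right_mem_side T _ _)

/-- The part of a side away from its root splits into the sides of the next edges. -/
lemma side_subset_iUnion {T : SimpleGraph V} {u v : V} :
    side T u v ⊆ {v} ∪ ⋃ w ∈ {w ∈ T.neighborSet v | w ≠ u}, side T v w := by
  intro x hx
  obtain ⟨p, hp⟩ := SimpleGraph.Reachable.exists_isPath hx
  cases p with
  | nil => exact Or.inl rfl
  | @cons _ w _ hvw q =>
    right
    rw [SimpleGraph.Walk.cons_isPath_iff] at hp
    rw [SimpleGraph.sdiff_adj, SimpleGraph.fromEdgeSet_adj] at hvw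
    refine Set.mem_biUnion (x := w) ⟨hvw.1, ?_⟩ ?_
    · rintro rfl
      exact hvw.2 ⟨Sym2.eq_swap, hvw.1.ne⟩
    · refine ⟨q.transfer _ fun e he => ?_⟩
      have heq := q.edges_subset_edgeSet he
      induction e with
      | h y z =>
        rw [SimpleGraph.mem_edgeSet, SimpleGraph.sdiff_adj] at heq
        rw [SimpleGraph.mem_edgeSet, SimpleGraph.sdiff_adj, SimpleGraph.fromEdgeSet_adj]
        refine ⟨heq.1, fun hc => hp.2 ?_⟩
        have hve : v ∈ s(y, z) := by rw [Set.mem_singleton_iff.1 hc.1]; simp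
        rcases Sym2.mem_iff.1 hve with rfl | rfl
        · exact q.fst_mem_support_of_mem_edges he
        · exact q.snd_mem_support_of_mem_edges he

lemma exists_next_side {T : SimpleGraph V} (hfin : ∀ v, (T.neighborSet v).Finite)
    (U : Ultrafilter V) (hU : ∀ v, {v}ᶜ ∈ U) {u v : V} (hs : side T u v ∈ U) :
    ∃ w, T.Adj v w ∧ w ≠ u ∧ side T v w ∈ U := by
  have h1 : {v} ∪ ⋃ w ∈ {w ∈ T.neighborSet v | w ≠ u}, side T v w ∈ U :=
    Filter.mem_of_superset hs side_subset_iUnion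
  rcases Ultrafilter.union_mem_iff.1 h1 with h | h
  · exact absurd h (Ultrafilter.compl_mem_iff_notMem.1 (hU v))
  · obtain ⟨w, hw, hwU⟩ := (Ultrafilter.finite_biUnion_mem_iff
      ((hfin v).subset (Set.sep_subset _ _))).1 h
    exact ⟨w, hw.1, hw.2, hwU⟩

/-- A ray of `T` starting along the edge `(u, v)` towards the end to which `U` converges. -/
lemma exists_nonbacktracking {T : SimpleGraph V} (hfin : ∀ v, (T.neighborSet v).Finite)
    (U : Ultrafilter V) (hU : ∀ v, {v}ᶜ ∈ U) {u v : V} (h : T.Adj u v) (hs : side T u v ∈ U) :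
    ∃ r : ℕ → V, r 0 = u ∧ r 1 = v ∧ (∀ n, T.Adj (r n) (r (n + 1))) ∧
      (∀ n, r (n + 2) ≠ r n) ∧ ∀ n, side T (r n) (r (n + 1)) ∈ U := by
  have : Nonempty V := ⟨u⟩
  choose! next hadj hne hside using
    fun (p : V × V) (hp : side T p.1 p.2 ∈ U) => exists_next_side hfin U hU hp
  let d : ℕ → V × V := fun n => (fun p => (p.2, next p))^[n] (u, v)
  have hd : ∀ n, d (n + 1) = ((d n).2, next (d n)) := fun n =>
    Function.iterate_succ_apply' _ _ _
  have hd2 : ∀ n, (d (n + 1)).1 = (d n).2 := fun n => by rw [hd]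
  have hdU : ∀ n, T.Adj (d n).1 (d n).2 ∧ side T (d n).1 (d n).2 ∈ U := by
    intro n
    induction n with
    | zero => exact ⟨h, hs⟩
    | succ n ih => rw [hd]; exact ⟨hadj _ ih.2, hside _ ih.2⟩
  refine ⟨fun n => (d n).1, rfl, hd2 0, fun n => ?_, fun n => ?_, fun n => ?_⟩
  · simpa only [hd2] using (hdU n).1
  · change (d (n + 1 + 1)).1 ≠ _
    rw [hd2, hd]
    exact hne _ (hdU n).2
  · simpa only [hd2] using (hdU n).2

lemma antitone_side {T : SimpleGraph V} (hT : T.IsAcyclic) {r : ℕ → V}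
    (hadj : ∀ n, T.Adj (r n) (r (n + 1))) (hnb : ∀ n, r (n + 2) ≠ r n) :
    Antitone fun n => side T (r n) (r (n + 1)) :=
  antitone_nat_of_succ_le fun n => side_subset_side hT (hadj n) (hadj (n + 1)) (hnb n)

lemma mem_side_of_lt {T : SimpleGraph V} (hT : T.IsAcyclic) {r : ℕ → V}
    (hadj : ∀ n, T.Adj (r n) (r (n + 1))) (hnb : ∀ n, r (n + 2) ≠ r n)
    {m n : ℕ} (h : m < n) : r n ∈ side T (r m) (r (m + 1)) := by
  obtain ⟨k, rfl⟩ := Nat.exists_eq_add_of_lt h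
  exact antitone_side hT hadj hnb (Nat.le_add_right m k) (right_mem_side T _ _)

lemma isRay_of_nonbacktracking {T : SimpleGraph V} (hT : T.IsAcyclic) {r : ℕ → V}
    (hadj : ∀ n, T.Adj (r n) (r (n + 1))) (hnb : ∀ n, r (n + 2) ≠ r n) : IsRay T r := by
  have key : ∀ m n, m < n → r m ≠ r n := fun m n h he =>
    left_notMem_side hT (hadj m) (he ▸ mem_side_of_lt hT hadj hnb h)
  refine ⟨fun m n he => ?_, hadj⟩
  by_contra hne
  rcases lt_or_gt_of_ne hne with h | h
  · exact key _ _ h he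
  · exact key _ _ h he.symm

lemma exists_notMem_side {T : SimpleGraph V} (hT : T.IsAcyclic) {r : ℕ → V}
    (hadj : ∀ n, T.Adj (r n) (r (n + 1))) (hnb : ∀ n, r (n + 2) ≠ r n)
    (w : V) : ∃ n, w ∉ side T (r n) (r (n + 1)) := by
  by_contra! hw
  have hreach : T.Reachable (r 0) w :=
    (hadj 0).reachable.trans (SimpleGraph.Reachable.mono sdiff_le (hw 0))
  obtain ⟨p⟩ := hreach
  have hsub : ∀ n, r n ∈ p.support := by
    intro n
    have hstart : r 0 ∉ side T (r n) (r (n + 1)) := fun h =>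
      left_notMem_side hT (hadj 0) (antitone_side hT hadj hnb (Nat.zero_le n) h)
    obtain ⟨d, hd, h1, h2⟩ := p.exists_boundary_dart (side T (r n) (r (n + 1)))ᶜ hstart
      (fun h => h (hw n))
    rw [Set.notMem_compl_iff] at h2
    rw [← (eq_of_leaves_side hT (hadj n) h2 d.adj.symm h1).2]
    exact p.dart_fst_mem_support_of_mem_darts hd
  exact Set.infinite_range_of_injective (isRay_of_nonbacktracking hT hadj hnb).1
    (p.support.finite_toSet.subset (Set.range_subset_iff.2 hsub))

lemma exists_side_avoiding {T : SimpleGraph V} (hT : T.IsAcyclic) {r : ℕ → V}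
    (hadj : ∀ n, T.Adj (r n) (r (n + 1))) (hnb : ∀ n, r (n + 2) ≠ r n)
    (K : Finset V) : ∃ n, ∀ w ∈ side T (r n) (r (n + 1)), w ∉ K := by
  choose N hN using exists_notMem_side hT hadj hnb
  exact ⟨K.sup N, fun w hw hwK =>
    hN w (antitone_side hT hadj hnb (Finset.le_sup hwK) hw)⟩

lemma ConnAvoiding.symm {G : SimpleGraph V} {K : Set V} {a b : V} (h : ConnAvoiding G K a b) :
    ConnAvoiding G K b a := by
  obtain ⟨p, hp⟩ := h
  exact ⟨p.reverse, fun v hv => hp v (by simpa using hv)⟩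

lemma ConnAvoiding.trans {G : SimpleGraph V} {K : Set V} {a b c : V}
    (h : ConnAvoiding G K a b) (h' : ConnAvoiding G K b c) : ConnAvoiding G K a c := by
  obtain ⟨p, hp⟩ := h
  obtain ⟨q, hq⟩ := h'
  refine ⟨p.append q, fun v hv => ?_⟩
  rcases (SimpleGraph.Walk.mem_support_append_iff _ _).1 hv with hv | hv
  · exact hp v hv
  · exact hq v hv

lemma ConnAvoiding.refl {G : SimpleGraph V} {K : Set V} {a : V} (h : a ∉ K) :
    ConnAvoiding G K a a := ⟨SimpleGraph.Walk.nil, by simpa using h⟩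

lemma ConnAvoiding.of_adj {G : SimpleGraph V} {K : Set V} {a b : V} (h : G.Adj a b)
    (ha : a ∉ K) (hb : b ∉ K) : ConnAvoiding G K a b :=
  ⟨h.toWalk, by simp [ha, hb]⟩

lemma ConnAvoiding.anti {G : SimpleGraph V} {K L : Set V} (hKL : K ⊆ L) {a b : V}
    (h : ConnAvoiding G L a b) : ConnAvoiding G K a b := by
  obtain ⟨p, hp⟩ := h
  exact ⟨p, fun v hv hvK => hp v hv (hKL hvK)⟩

lemma ConnAvoiding.notMem_left {G : SimpleGraph V} {K : Set V} {a b : V}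
    (h : ConnAvoiding G K a b) : a ∉ K := by
  obtain ⟨p, hp⟩ := h
  exact hp a p.start_mem_support

lemma connAvoiding_of_mem_side {G T : SimpleGraph V} (hTG : T ≤ G) {K : Set V} {u v x y : V}
    (hK : ∀ w ∈ side T u v, w ∉ K) (hx : x ∈ side T u v) (hy : y ∈ side T u v) :
    ConnAvoiding G K x y := by
  have key : ∀ {w}, w ∈ side T u v → ConnAvoiding G K v w := fun hw =>
    side_induction (P := fun w => ConnAvoiding G K v w)
      (ConnAvoiding.refl (hK v (right_mem_side T u v)))
      (fun x y hx hy hxy ih =>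
        ih.trans (ConnAvoiding.of_adj (hTG hxy) (hK x hx) (hK y hy))) hw
  exact (key hx).symm.trans (key hy)

/-- The two sides of an edge of an end-respecting tree are separated by a finite set. -/
lemma exists_finset_separating {G T : SimpleGraph V} (hTG : T ≤ G) (hT : T.IsAcyclic)
    (hfin : ∀ v, (T.neighborSet v).Finite) (hresp : EndRespecting G T) {a b : V}
    (hab : T.Adj a b) :
    ∃ K : Finset V, ∀ x ∈ side T b a, ∀ y ∈ side T a b, ¬ ConnAvoiding G ↑K x y := by
  by_contra! hcon
  let P : Finset V → Set (V × V) := fun K =>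
    {p | p.1 ∈ side T b a ∧ p.2 ∈ side T a b ∧ ConnAvoiding G ↑K p.1 p.2}
  have hPanti : ∀ K L, K ⊆ L → P L ⊆ P K := fun K L h p hp =>
    ⟨hp.1, hp.2.1, hp.2.2.anti (by exact_mod_cast h)⟩
  have hne : (⨅ K, Filter.principal (P K)).NeBot := by
    have : Nonempty (V × V) := ⟨(a, b)⟩
    refine Filter.iInf_neBot_of_directed (fun K L => ⟨K ∪ L, ?_, ?_⟩) fun K => ?_
    · exact Filter.principal_mono.2 (hPanti _ _ Finset.subset_union_left)
    · exact Filter.principal_mono.2 (hPanti _ _ Finset.subset_union_right)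
    · obtain ⟨x, hx, y, hy, h⟩ := hcon K
      exact Filter.principal_neBot_iff.2 ⟨(x, y), hx, hy, h⟩
  let U := Ultrafilter.of (⨅ K, Filter.principal (P K))
  have hPU : ∀ K, P K ∈ U := fun K =>
    Ultrafilter.of_le _ (Filter.mem_iInf_of_mem K (Filter.mem_principal_self _))
  have h1 : ∀ v, {v}ᶜ ∈ U.map Prod.fst := fun v =>
    Ultrafilter.mem_map.2 <| Filter.mem_of_superset (hPU {v}) fun p hp => by
      simpa using hp.2.2.notMem_left
  have h2 : ∀ v, {v}ᶜ ∈ U.map Prod.snd := fun v =>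
    Ultrafilter.mem_map.2 <| Filter.mem_of_superset (hPU {v}) fun p hp => by
      simpa using hp.2.2.symm.notMem_left
  obtain ⟨r, hr0, hr1, hradj, hrnb, hrU⟩ := exists_nonbacktracking hfin (U.map Prod.fst) h1
    hab.symm (Ultrafilter.mem_map.2 <| Filter.mem_of_superset (hPU ∅) fun p hp => hp.1)
  obtain ⟨s, hs0, hs1, hsadj, hsnb, hsU⟩ := exists_nonbacktracking hfin (U.map Prod.snd) h2
    hab (Ultrafilter.mem_map.2 <| Filter.mem_of_superset (hPU ∅) fun p hp => hp.2.1)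
  have hequiv : RayEquiv G r s := by
    intro K
    obtain ⟨i, hi⟩ := exists_side_avoiding hT hradj hrnb K
    obtain ⟨j, hj⟩ := exists_side_avoiding hT hsadj hsnb K
    obtain ⟨p, ⟨hp1, hp2⟩, hp⟩ :=
      U.nonempty_of_mem (Filter.inter_mem (Filter.inter_mem (hrU i) (hsU j)) (hPU K))
    refine ⟨max i j + 1, fun n hn m hm => ?_⟩
    have hx := connAvoiding_of_mem_side (K := ↑K) hTG (fun w hw => by simpa using hi w hw)
      (mem_side_of_lt hT hradj hrnb (show i < n by omega)) hp1
    have hy := connAvoiding_of_mem_side (K := ↑K) hTG (fun w hw => by simpa using hj w hw)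
      hp2 (mem_side_of_lt hT hsadj hsnb (show j < m by omega))
    exact (hx.trans hp.2.2).trans hy
  obtain ⟨N, hN⟩ := hresp r s (isRay_of_nonbacktracking hT hradj hrnb)
    (isRay_of_nonbacktracking hT hsadj hsnb) hequiv {a}
  obtain ⟨p, hp⟩ := hN (N + 1) (by omega) (N + 1) (by omega)
  have hr := mem_side_of_lt hT hradj hrnb (Nat.succ_pos N)
  have hs := mem_side_of_lt hT hsadj hsnb (Nat.succ_pos N)
  rw [zero_add, hr0, hr1] at hr
  rw [zero_add, hs0, hs1] at hs
  obtain ⟨d, hd, hd1, hd2⟩ := p.exists_boundary_dart _ hr (disjoint_side_swap hT hab hs)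
  refine hp _ (p.dart_fst_mem_support_of_mem_darts hd) ?_
  simpa using (eq_of_leaves_side hT hab.symm hd1 d.adj hd2).1

/-- The oriented edges inside `W` leading out of `S`. -/
noncomputable def cut (W : Finset V) (S : Set V) : Finset (V × V) :=
  (W ×ˢ W).filter fun p => p.1 ∈ S ∧ p.2 ∉ S

lemma sum_alternating_eq_zero {R : Type*} [CommRing R] {f : V → V → R}
    (hanti : ∀ u v, f u v = - f v u) (hdiag : ∀ u, f u u = 0) (s : Finset V) :
    ∑ p ∈ s ×ˢ s, f p.1 p.2 = 0 := by
  refine Finset.sum_involution (fun p _ => p.swap) (fun p _ => ?_) (fun p _ hp he => hp ?_)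
    (fun p hp => ?_) (fun p _ => Prod.swap_swap p)
  · rw [hanti]; simp
  · have : p.2 = p.1 := congrArg Prod.fst he
    rw [this, hdiag]
  · simpa [and_comm] using hp

lemma sum_cut {R : Type*} [CommRing R] {f : V → V → R}
    (hanti : ∀ u v, f u v = - f v u) (hdiag : ∀ u, f u u = 0) (W : Finset V) (S : Set V) :
    ∑ p ∈ cut W S, f p.1 p.2 = ∑ x ∈ W.filter (· ∈ S), ∑ y ∈ W, f x y := by
  have h := sum_alternating_eq_zero hanti hdiag (W.filter (· ∈ S))
  rw [← Finset.sum_product', ← add_zero (∑ p ∈ cut W S, f p.1 p.2), ← h,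
    ← Finset.sum_union]
  · congr 1
    ext p
    simp only [cut, Finset.mem_union, Finset.mem_filter, Finset.mem_product]
    tauto
  · rw [Finset.disjoint_left]
    intro p
    simp only [cut, Finset.mem_filter, Finset.mem_product]
    tauto

lemma traversals_sum {G : SimpleGraph V} {u v : V} (p : G.Walk u v) (D : Finset (V × V)) :
    ∑ e ∈ D, (traversals p e.1 e.2 : ℤ) =
      ∑ i ∈ Finset.range p.length, if (p.getVert i, p.getVert (i + 1)) ∈ D then 1 else 0 := by
  simp only [traversals, Finset.card_filter, Nat.cast_sum]
  rw [Finset.sum_comm]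
  refine Finset.sum_congr rfl fun i _ => ?_
  rw [← Finset.sum_ite_eq D (p.getVert i, p.getVert (i + 1)) fun _ => (1 : ℤ)]
  refine Finset.sum_congr rfl fun e _ => ?_
  simp [Prod.ext_iff]

lemma sum_cut_walkChain {G : SimpleGraph V} {W : Finset V} {S : Set V}
    (hW : ∀ x y, G.Adj x y → x ∈ S → y ∉ S → x ∈ W ∧ y ∈ W) {u v : V} (p : G.Walk u v) :
    ∑ e ∈ cut W S, walkChain p e.1 e.2 = (if u ∈ S then 1 else 0) - (if v ∈ S then 1 else 0) := by
  have hswap : ∑ e ∈ cut W S, (traversals p e.2 e.1 : ℤ) =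
      ∑ e ∈ (cut W S).map (Equiv.prodComm V V).toEmbedding, (traversals p e.1 e.2 : ℤ) := by
    simp
  simp only [walkChain]
  rw [Finset.sum_sub_distrib, hswap, traversals_sum, traversals_sum, ← Finset.sum_sub_distrib]
  have htel := Finset.sum_range_sub' (fun i => if p.getVert i ∈ S then (1 : ℤ) else 0) p.length
  rw [p.getVert_zero, p.getVert_length] at htel
  rw [← htel]
  refine Finset.sum_congr rfl fun i hi => ?_
  have hadj := p.adj_getVert_succ (Finset.mem_range.1 hi)
  have h1 := hW _ _ hadj
  have h2 := hW _ _ hadj.symm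
  have e1 : (p.getVert i, p.getVert (i + 1)) ∈ cut W S ↔
      p.getVert i ∈ S ∧ p.getVert (i + 1) ∉ S := by
    simp only [cut, Finset.mem_filter, Finset.mem_product]
    tauto
  have e2 : (p.getVert i, p.getVert (i + 1)) ∈
      (cut W S).map (Equiv.prodComm V V).toEmbedding ↔
      p.getVert (i + 1) ∈ S ∧ p.getVert i ∉ S := by
    simp only [cut, Finset.mem_map_equiv, Finset.mem_filter, Finset.mem_product,
      Equiv.prodComm_symm, Equiv.prodComm_apply, Prod.swap_prod_mk]
    tauto
  simp only [e1, e2]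
  by_cases hx : p.getVert i ∈ S <;> by_cases hy : p.getVert (i + 1) ∈ S <;> simp [hx, hy]

lemma walkChain_eq_zero {G : SimpleGraph V} {u v : V} {p : G.Walk u v} {a b : V}
    (h : ¬ OnWalk p a b) : walkChain p a b = 0 := by
  have h1 : traversals p a b = 0 := by
    rw [traversals, Finset.card_eq_zero, Finset.filter_eq_empty_iff]
    exact fun i hi hc => h ⟨i, Finset.mem_range.1 hi, Or.inl hc⟩
  have h2 : traversals p b a = 0 := by
    rw [traversals, Finset.card_eq_zero, Finset.filter_eq_empty_iff]
    exact fun i hi hc => h ⟨i, Finset.mem_range.1 hi, Or.inr hc⟩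
  simp [walkChain, h1, h2]

lemma sum_cut_circuits {R : Type*} [CommRing R] {G : SimpleGraph V} {g : Circuit G → R}
    (hthin : ∀ a b : V, {c : Circuit G | g c ≠ 0 ∧ OnWalk c.2 a b}.Finite)
    {W : Finset V} {S : Set V} (hW : ∀ x y, G.Adj x y → x ∈ S → y ∉ S → x ∈ W ∧ y ∈ W) :
    ∑ e ∈ cut W S, ∑ᶠ c : Circuit G, g c * (walkChain c.2 e.1 e.2 : R) = 0 := by
  rw [← finsum_sum_comm]
  · refine finsum_eq_zero_of_forall_eq_zero fun c => ?_
    rw [← Finset.mul_sum, ← Int.cast_sum, sum_cut_walkChain hW, sub_self, Int.cast_zero, mul_zero]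
  · refine fun e _ => (hthin e.1 e.2).subset fun c hc => ⟨fun h0 => hc ?_, ?_⟩
    · simp [h0]
    · by_contra h
      exact hc (by simp [walkChain_eq_zero h])

/-- A flow on an end-respecting tree that is a thin sum of circuits vanishes. -/
theorem flow_eq_zero_of_thin_sum {R : Type*} [CommRing R] {G T : SimpleGraph V}
    (hfin : ∀ v, (G.neighborSet v).Finite) (hsub : IsSubtree G T) (hresp : EndRespecting G T)
    {f : V → V → R} (hanti : ∀ u v, f u v = - f v u) (hsupp : ∀ u v, f u v ≠ 0 → T.Adj u v)
    (hdiv : ∀ v, ∑ᶠ u, f v u = 0) {g : Circuit G → R}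
    (hthin : ∀ a b : V, {c : Circuit G | g c ≠ 0 ∧ OnWalk c.2 a b}.Finite)
    (hf : ∀ a b, f a b = ∑ᶠ c : Circuit G, g c * (walkChain c.2 a b : R)) : f = 0 := by
  obtain ⟨hTG, hT, -, hTconn⟩ := hsub
  have hdiag : ∀ u, f u u = 0 := fun u => by_contra fun h => (hsupp u u h).ne rfl
  funext a b
  by_contra hne
  have hab := hsupp a b hne
  obtain ⟨K, hK⟩ := exists_finset_separating hTG hT
    (fun v => (hfin v).subset fun w hw => hTG hw) hresp hab
  let A : Set V := {w | ∃ x ∈ side T b a, ConnAvoiding G ↑K x w}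
  let W : Finset V := insert a (insert b (K ∪ K.biUnion fun v => (hfin v).toFinset))
  have hKW : ∀ v ∈ K, v ∈ W := fun v hv => by simp [W, hv]
  have hNW : ∀ v ∈ K, ∀ w, G.Adj v w → w ∈ W := fun v hv w hw => by
    have : ∃ v ∈ K, G.Adj v w := ⟨v, hv, hw⟩
    simp [W, this]
  have hcutA : ∀ x y, G.Adj x y → x ∈ A → y ∉ A → x ∈ W ∧ y ∈ W := by
    rintro x y hxy ⟨z, hz, hzx⟩ hy
    have hyK : y ∈ K := by
      by_contra hyK
      exact hy ⟨z, hz, hzx.trans (ConnAvoiding.of_adj hxy hzx.symm.notMem_left (by simpa))⟩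
    exact ⟨hNW y hyK x hxy.symm, hKW y hyK⟩
  have hAside : ∀ x y, T.Adj x y → (x ∈ A ↔ x ∈ side T b a ∧ x ∉ K) := by
    intro x y hxy
    constructor
    · rintro ⟨z, hz, hzx⟩
      refine ⟨?_, by simpa using hzx.symm.notMem_left⟩
      obtain ⟨p, -⟩ := hTconn a ⟨b, hab⟩ x ⟨y, hxy⟩
      exact (mem_side_or_mem_side hT hab.symm ⟨p⟩).resolve_right fun h => hK z hz x h hzx
    · rintro ⟨hx, hxK⟩
      exact ⟨x, hx, ConnAvoiding.refl (by simpa)⟩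
  have hdivK : ∀ x ∈ K, ∑ y ∈ W, f x y = 0 := by
    intro x hx
    rw [← hdiv x, finsum_eq_sum_of_support_subset]
    exact fun y hy => hNW x hx y (hTG (hsupp x y hy))
  have hdivT : ∀ x, (∀ y, ¬ T.Adj x y) → ∑ y ∈ W, f x y = 0 := fun x hx =>
    Finset.sum_eq_zero fun y _ => by_contra fun h => hx y (hsupp x y h)
  have hA : ∑ p ∈ cut W A, f p.1 p.2 = ∑ p ∈ cut W (side T b a), f p.1 p.2 := by
    rw [sum_cut hanti hdiag, sum_cut hanti hdiag, Finset.sum_filter, Finset.sum_filter]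
    refine Finset.sum_congr rfl fun x _ => ?_
    by_cases hx : ∃ y, T.Adj x y
    · obtain ⟨y, hxy⟩ := hx
      by_cases hxK : x ∈ K
      · simp [hdivK x hxK]
      · simp [hAside x y hxy, hxK]
    · simp [hdivT x (not_exists.1 hx)]
  have hside : ∑ p ∈ cut W (side T b a), f p.1 p.2 = f a b := by
    refine Finset.sum_eq_single_of_mem (a, b) ?_ fun p hp hpne => ?_
    · simp [cut, W, right_mem_side, left_notMem_side hT hab.symm]
    · by_contra h
      simp only [cut, Finset.mem_filter] at hp
      obtain ⟨h1, h2⟩ := eq_of_leaves_side hT hab.symm hp.2.1 (hsupp _ _ h) hp.2.2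
      exact hpne (Prod.ext h1 h2)
  refine hne ?_
  rw [← hside, ← hA]
  simp only [hf]
  exact sum_cut_circuits hthin hcutA

lemma flow_sub_mem {T : SimpleGraph V} (hfin : ∀ v, (T.neighborSet v).Finite)
    {f g : V → V → ℤ} (hf : f ∈ Zsuf1 T) (hg : g ∈ Zsuf1 T) : f - g ∈ Zsuf1 T := by
  obtain ⟨⟨hfa, hfs⟩, ⟨C, hC⟩, hfd⟩ := hf
  obtain ⟨⟨hga, hgs⟩, ⟨D, hD⟩, hgd⟩ := hg
  refine ⟨⟨fun u v => ?_, fun u v h => ?_⟩, ⟨C + D, fun u v => ?_⟩, fun v => ?_⟩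
  · simp only [Pi.sub_apply]
    linarith [hfa u v, hga u v]
  · by_contra hadj
    have h1 : f u v = 0 := by_contra fun h => hadj (hfs u v h)
    have h2 : g u v = 0 := by_contra fun h => hadj (hgs u v h)
    exact h (by simp [h1, h2])
  · push_cast
    exact (abs_sub _ _).trans (add_le_add (hC u v) (hD u v))
  · have h := finsum_sub_distrib (f := fun u => f u v) (g := fun u => g u v)
      ((hfin v).subset fun u hu => (hfs u v hu).symm)
      ((hfin v).subset fun u hu => (hgs u v hu).symm)
    change ∑ᶠ u, (f u v - g u v) = 0
    rw [h]
    change chainDiv f v - chainDiv g v = 0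
    rw [hfd, hgd, sub_zero]

lemma walkChainZ2_eq {G : SimpleGraph V} {u v : V} (p : G.Walk u v) (a b : V) :
    walkChainZ2 p a b = (walkChain p a b : ZMod 2) := by
  simp [walkChainZ2, walkChain, CharTwo.sub_eq_add]

/-- end-respecting trees (without separators) inject in first
uniformly finite homology. -/
theorem stmt5 (G T : SimpleGraph V) (hulf : ULF G) (hconn : G.Connected)
    (hsub : IsSubtree G T) (hleaf : Leafless T) (hresp : EndRespecting G T) :
    (∀ f : V → V → ℤ, f ∈ Zsuf1 T → f ∈ Cthin G → f = 0) ∧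
    (∀ f g : V → V → ℤ, f ∈ Zsuf1 T → g ∈ Zsuf1 T → f - g ∈ Cinf G → f = g) ∧
    (∀ f : V → V → ZMod 2, f ∈ Zsuf1Z2 T → f ∈ CthinZ2 G → f = 0) := by
  obtain ⟨D, hD⟩ := hulf
  have hfin : ∀ v, (G.neighborSet v).Finite := fun v => (hD v).1
  have hint : ∀ f : V → V → ℤ, f ∈ Zsuf1 T → f ∈ Cthin G → f = 0 := by
    rintro f ⟨⟨hanti, hsupp⟩, -, hdiv⟩ ⟨g, hthin, -, hf⟩
    refine flow_eq_zero_of_thin_sum hfin hsub hresp hanti hsupp (fun v => ?_) hthin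
      (fun a b => by simpa [circSum] using congrFun (congrFun hf a) b)
    rw [finsum_congr fun u => hanti v u, finsum_neg_distrib, neg_eq_zero]
    exact hdiv v
  refine ⟨hint, fun f g hf hg hfg => ?_, ?_⟩
  · have hmem := flow_sub_mem (fun v => (hfin v).subset fun w hw => hsub.1 hw) hf hg
    obtain ⟨r, h, -, -, hthin, hh⟩ := Set.mem_iUnion.1 hfg
    exact sub_eq_zero.1 (hint _ hmem ⟨h, hthin, hmem.2.1, hh⟩)
  · rintro f ⟨⟨hsymm, hsupp⟩, hdiv⟩ ⟨g, hthin, hf⟩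
    refine flow_eq_zero_of_thin_sum hfin hsub hresp
      (fun u v => by rw [CharTwo.neg_eq]; exact hsymm u v) hsupp (fun v => ?_) hthin
      (fun a b => by simpa [circSumZ2, walkChainZ2_eq] using congrFun (congrFun hf a) b)
    rw [finsum_congr fun u => hsymm v u]
    exact hdiv v

end UFH
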